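/- Let f be a function of critical growth on 𝔹². Let {u_k} and {v_k} be sequences of H¹_R(𝔹²)-functions with sup_k (‖u_k‖ + ∫_B u_k² dv_g) < ∞ and sup_k (‖v_k‖ + ∫_B v_k² dv_g) < ∞, converging almost everywhere on B to H¹_R(𝔹²)-functions u and v respectively (as holds, up to a subsequence, for weakly convergent sequences in H¹_R(𝔹²)), and assume sup_k ‖u_k‖² < 4π/λ. Then for every integer l ≥ 2, lim_{k→∞} ∫_B (f(x,u_k(x))/u_k(x)) v_k(x)^l dv_g = ∫_B (f(x,u(x))/u(x)) v(x)^l dv_g, where the quotient f(x,t)/t is defined to be 0 at t = 0. -/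

import Mathlib

open MeasureTheory Real Set Filter

noncomputable section

/-- Points of the plane. -/
abbrev Pt := EuclideanSpace ℝ (Fin 2)

/-- The open unit disc `B = {x ∈ ℝ² : |x| < 1}`. -/
def B : Set Pt := Metric.ball 0 1

/-- The density of the hyperbolic volume measure `dv_g = (2/(1-|x|²))² dx`. -/
def dens (x : Pt) : ℝ := (2 / (1 - ‖x‖ ^ 2)) ^ 2

/-- Integral with respect to the hyperbolic volume measure on `B`. -/
def hInt (φ : Pt → ℝ) : ℝ := ∫ x in B, φ x * dens x

/-- Integrability with respect to the hyperbolic volume measure on `B`. -/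
def HIntegrable (φ : Pt → ℝ) : Prop := IntegrableOn (fun x => φ x * dens x) B volume

/-- The squared Euclidean Dirichlet norm `‖u‖² = ∫_B |∇u|² dx` (which equals the
hyperbolic Dirichlet energy by conformal invariance). -/
def enormSq (u : Pt → ℝ) : ℝ := ∫ x in B, ‖gradient u x‖ ^ 2

/-- `u` is an `H¹(𝔹²)`-function: differentiable on `B`, with finite Dirichlet
energy and finite hyperbolic `L²` norm. -/
def IsH1 (u : Pt → ℝ) : Prop :=
  DifferentiableOn ℝ u B ∧
  IntegrableOn (fun x => ‖gradient u x‖ ^ 2) B volume ∧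
  HIntegrable (fun x => (u x) ^ 2)

/-- `u` is an `H¹_R(𝔹²)`-function: an `H¹(𝔹²)`-function which is radial. -/
def IsH1R (u : Pt → ℝ) : Prop :=
  IsH1 u ∧ ∀ x y : Pt, ‖x‖ = ‖y‖ → u x = u y

/-- The nonlinearity `f(x,t) = h(x,t)(e^{λt²} - 1)`. -/
def fn (lam : ℝ) (h : Pt → ℝ → ℝ) (x : Pt) (t : ℝ) : ℝ :=
  h x t * (Real.exp (lam * t ^ 2) - 1)

/-- The primitive `F(x,t) = ∫₀^t f(x,s) ds`. -/
def Fn (lam : ℝ) (h : Pt → ℝ → ℝ) (x : Pt) (t : ℝ) : ℝ :=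
  ∫ s in (0 : ℝ)..t, fn lam h x s

/-- The functional `I_λ(u) = (1/2)∫_B f(x,u)u dv_g - ∫_B F(x,u) dv_g`. -/
def Ilam (lam : ℝ) (h : Pt → ℝ → ℝ) (u : Pt → ℝ) : ℝ :=
  (1 / 2) * hInt (fun x => fn lam h x (u x) * u x) - hInt (fun x => Fn lam h x (u x))

/-- `f(x,t) = h(x,t)(e^{λt²} - 1)` is a function of critical growth on `𝔹²`. -/
structure CriticalGrowth (lam : ℝ) (h : Pt → ℝ → ℝ) : Prop where
  lam_pos : 0 < lam
  h_C1 : ContDiff ℝ 1 (Function.uncurry h)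
  f_pos : ∀ x ∈ B, ∀ t : ℝ, 0 < t → 0 < fn lam h x t
  f_odd : ∀ x ∈ B, ∀ t : ℝ, fn lam h x (-t) = -fn lam h x t
  /-- (C1), first part: `h` is bounded on `B × [-L, L]` for every `L > 0`. -/
  h_bdd : ∀ L : ℝ, 0 < L → ∃ C : ℝ, ∀ x ∈ B, ∀ t : ℝ, |t| ≤ L → |h x t| ≤ C
  /-- (C1), second part: `sup_{x ∈ B} |h(x,t)| ≤ C tᵃ` near `t = 0`. -/
  h_zero : ∃ a C δ : ℝ, 0 < a ∧ 0 < C ∧ 0 < δ ∧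
    ∀ x ∈ B, ∀ t : ℝ, 0 < t → t < δ → |h x t| ≤ C * t ^ a
  /-- (C2): `∂f/∂t (x,t) > f(x,t)/t` for `t > 0`. -/
  f_super : ∀ x ∈ B, ∀ t : ℝ, 0 < t → fn lam h x t / t < deriv (fun s => fn lam h x s) t
  /-- (C3): `F(x,t) ≤ M₁(g(x) + f(x,t))` with `0 ≤ g ∈ L¹(B, dv_g)`. -/
  F_bound : ∃ M₁ : ℝ, 0 < M₁ ∧ ∃ g : Pt → ℝ, (∀ x, 0 ≤ g x) ∧ HIntegrable g ∧
    ∀ x ∈ B, ∀ t : ℝ, 0 < t → Fn lam h x t ≤ M₁ * (g x + fn lam h x t)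
  /-- (C4), first part: `inf_{x ∈ K} h(x,t) e^{εt²} → ∞` as `t → ∞`,
  for every compact `K ⊆ B`. -/
  h_inf : ∀ ε : ℝ, 0 < ε → ∀ K : Set Pt, K ⊆ B → IsCompact K →
    ∀ c : ℝ, ∃ T : ℝ, ∀ t : ℝ, T ≤ t → ∀ x ∈ K, c ≤ h x t * Real.exp (ε * t ^ 2)
  /-- (C4), second part: `sup_{x ∈ B} h(x,t) e^{-εt²} → 0` as `t → ∞`. -/
  h_sup : ∀ ε : ℝ, 0 < ε → ∀ c : ℝ, 0 < c → ∃ T : ℝ, ∀ t : ℝ, T ≤ t → ∀ x ∈ B,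
    h x t * Real.exp (-ε * t ^ 2) < c

/-- The quotient `f(x,t)/t`, defined as `0` at `t = 0`. -/
def fq (lam : ℝ) (h : Pt → ℝ → ℝ) (x : Pt) (t : ℝ) : ℝ :=
  if t = 0 then 0 else fn lam h x t / t

lemma measurableSet_B : MeasurableSet B := Metric.isOpen_ball.measurableSet

lemma IsH1R.hasDerivAt_ray {u : Pt → ℝ} (hu : IsH1R u) (e : Pt) {r : ℝ} (hr : r • e ∈ B) :
    HasDerivAt (fun s : ℝ => u (s • e)) (inner ℝ (gradient u (r • e)) e) r := by
  have hd : DifferentiableAt ℝ u (r • e) :=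
    hu.1.1.differentiableAt (Metric.isOpen_ball.mem_nhds hr)
  have h1 := (hasGradientAt_iff_hasFDerivAt.1 hd.hasGradientAt)
  have h2 : HasDerivAt (fun s : ℝ => s • e) e r := by
    simpa using (hasDerivAt_id r).smul_const e
  have h3 := h1.comp_hasDerivAt r h2
  rw [InnerProductSpace.toDual_apply_apply] at h3
  exact h3

/-- A fixed unit vector of the plane. -/
def e₁ : Pt := EuclideanSpace.single 0 1

lemma norm_e₁ : ‖e₁‖ = 1 := by simp [e₁]

/-- The profile `r ↦ u(r e₁)` of a radial function `u`. -/
def profile (u : Pt → ℝ) (r : ℝ) : ℝ := u (r • e₁)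

lemma smul_mem_B {e : Pt} (he : ‖e‖ = 1) {r : ℝ} (h0 : 0 ≤ r) (h1 : r < 1) : r • e ∈ B := by
  simp [B, norm_smul, he, abs_of_nonneg h0, h1]

lemma IsH1R.eq_profile {u : Pt → ℝ} (hu : IsH1R u) (x : Pt) : u x = profile u ‖x‖ :=
  hu.2 _ _ (by simp [norm_smul, norm_e₁])

lemma IsH1R.hasDerivAt_profile {u : Pt → ℝ} (hu : IsH1R u) {r : ℝ} (h0 : 0 ≤ r)
    (h1 : r < 1) : HasDerivAt (profile u) (deriv (profile u) r) r :=
  (hu.hasDerivAt_ray e₁ (smul_mem_B norm_e₁ h0 h1)).differentiableAt.hasDerivAt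

lemma IsH1R.abs_deriv_profile_le {u : Pt → ℝ} (hu : IsH1R u) {x : Pt} (hx : x ∈ B)
    (hx0 : x ≠ 0) : |deriv (profile u) ‖x‖| ≤ ‖gradient u x‖ := by
  have hn : ‖x‖ ≠ 0 := norm_ne_zero_iff.2 hx0
  set e : Pt := ‖x‖⁻¹ • x with he
  have hne : ‖e‖ = 1 := by simp [he, norm_smul, hn]
  have hxe : ‖x‖ • e = x := by simp [he, smul_smul, hn]
  have hp : profile u = fun s : ℝ => u (s • e) := by
    ext s
    exact hu.2 _ _ (by simp [norm_smul, norm_e₁, hne])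
  have hd := hu.hasDerivAt_ray e (r := ‖x‖) (by rwa [hxe])
  rw [hxe] at hd
  rw [hp, hd.deriv]
  simpa [hne] using abs_real_inner_le_norm (gradient u x) e

lemma integrable_radial_iff (f : ℝ → ℝ) :
    IntegrableOn (fun x : Pt => f ‖x‖) B ↔ IntegrableOn (fun t => t * f t) (Ioo 0 1) := by
  have h1 : IntegrableOn (fun x : Pt => f ‖x‖) B ↔
      Integrable (fun x : Pt => (Iio 1).indicator f ‖x‖) := by
    rw [← integrable_indicator_iff measurableSet_B]
    refine integrable_congr (Eventually.of_forall fun x => ?_)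
    simp [indicator, B]
  rw [h1, integrable_fun_norm_addHaar volume (f := (Iio 1).indicator f)]
  have h2 : (fun y : ℝ => y ^ (Module.finrank ℝ Pt - 1) • (Iio 1).indicator f y) =
      (Iio 1).indicator (fun t => t * f t) := by
    ext y
    by_cases hy : y < 1 <;> simp [indicator, hy]
  rw [h2, IntegrableOn, integrable_indicator_iff measurableSet_Iio, IntegrableOn,
    Measure.restrict_restrict measurableSet_Iio, inter_comm, Ioi_inter_Iio, IntegrableOn]

lemma integral_radial (f : ℝ → ℝ) :
    ∫ x in B, f ‖x‖ = 2 * π * ∫ t in Ioo 0 1, t * f t := by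
  have h1 : ∫ x in B, f ‖x‖ = ∫ x : Pt, (Iio 1).indicator f ‖x‖ := by
    rw [← integral_indicator measurableSet_B]
    refine integral_congr_ae (Eventually.of_forall fun x => ?_)
    simp [indicator, B]
  rw [h1, integral_fun_norm_addHaar volume ((Iio 1).indicator f)]
  have h2 : (fun y : ℝ => y ^ (Module.finrank ℝ Pt - 1) • (Iio 1).indicator f y) =
      (Iio 1).indicator (fun t => t * f t) := by
    ext y
    by_cases hy : y < 1 <;> simp [indicator, hy]
  rw [h2, integral_indicator measurableSet_Iio,
    Measure.restrict_restrict measurableSet_Iio, inter_comm, Ioi_inter_Iio]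
  simp [Measure.real, EuclideanSpace.volume_ball_fin_two, Real.pi_pos.le]
  ring

lemma ae_restrict_B_ne_zero : ∀ᵐ x : Pt ∂(volume.restrict B), x ∈ B ∧ x ≠ 0 := by
  filter_upwards [ae_restrict_mem measurableSet_B,
    Measure.ae_ne (volume.restrict B) (0 : Pt)] with x hx hx0
  exact ⟨hx, hx0⟩

lemma IsH1R.integrableOn_profile {u : Pt → ℝ} (hu : IsH1R u) :
    IntegrableOn (fun x : Pt => (deriv (profile u) ‖x‖) ^ 2) B := by
  refine Integrable.mono' hu.1.2.1
    (((measurable_deriv _).comp measurable_norm).pow_const 2).aestronglyMeasurable ?_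
  filter_upwards [ae_restrict_B_ne_zero] with x hx
  rw [Real.norm_of_nonneg (sq_nonneg _), ← sq_abs]
  gcongr
  exact hu.abs_deriv_profile_le hx.1 hx.2

lemma IsH1R.integral_profile_le {u : Pt → ℝ} (hu : IsH1R u) :
    2 * π * ∫ t in Ioo 0 1, t * (deriv (profile u) t) ^ 2 ≤ enormSq u := by
  rw [← integral_radial (fun t => (deriv (profile u) t) ^ 2)]
  refine integral_mono_ae hu.integrableOn_profile hu.1.2.1 ?_
  filter_upwards [ae_restrict_B_ne_zero] with x hx
  refine (sq_abs _).symm.trans_le ?_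
  gcongr
  exact hu.abs_deriv_profile_le hx.1 hx.2

lemma IsH1R.sq_sub_le {u : Pt → ℝ} (hu : IsH1R u) {r s : ℝ} (hr : 0 < r) (hrs : r < s)
    (hs : s < 1) :
    (profile u s - profile u r) ^ 2 ≤ enormSq u / (2 * π) * Real.log (s / r) := by
  set U' := deriv (profile u) with hU'
  have hL : 0 < Real.log (s / r) := Real.log_pos (by rwa [one_lt_div hr])
  have hsub : Ioc r s ⊆ Ioo 0 1 := fun t ht => ⟨hr.trans ht.1, ht.2.trans_lt hs⟩
  have hI := (integrable_radial_iff (fun t => (U' t) ^ 2)).1 hu.integrableOn_profile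
  have hA : IntervalIntegrable (fun t => t * (U' t) ^ 2) volume r s :=
    (intervalIntegrable_iff_integrableOn_Ioc_of_le hrs.le).2 (hI.mono_set hsub)
  have hinv : IntervalIntegrable (fun t : ℝ => t⁻¹) volume r s := by
    refine (continuousOn_inv₀.mono fun t ht => ?_).intervalIntegrable
    rw [uIcc_of_le hrs.le] at ht
    exact (hr.trans_le ht.1).ne'
  have hD : IntervalIntegrable U' volume r s := by
    rw [intervalIntegrable_iff_integrableOn_Ioc_of_le hrs.le] at hA hinv ⊢
    refine Integrable.mono' (hA.add hinv) (measurable_deriv _).aestronglyMeasurable ?_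
    filter_upwards [ae_restrict_mem measurableSet_Ioc] with t ht
    have ht0 : 0 < t := hr.trans ht.1
    have h1 : 0 ≤ t⁻¹ * (t * |U' t| - 1) ^ 2 := by positivity
    have h2 : t⁻¹ * (t * |U' t| - 1) ^ 2 = t * U' t ^ 2 + t⁻¹ - 2 * |U' t| := by
      rw [← sq_abs (U' t)]; field_simp; ring
    have h3 := abs_nonneg (U' t)
    simp only [Pi.add_apply, Real.norm_eq_abs]
    linarith
  have hftc : ∫ t in r..s, U' t = profile u s - profile u r := by
    refine intervalIntegral.integral_eq_sub_of_hasDerivAt (fun t ht => ?_) hD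
    rw [uIcc_of_le hrs.le] at ht
    exact hu.hasDerivAt_profile (hr.le.trans ht.1) (ht.2.trans_lt hs)
  have hAle : ∫ t in r..s, t * (U' t) ^ 2 ≤ enormSq u / (2 * π) := by
    rw [le_div_iff₀' (by positivity)]
    refine le_trans ?_ hu.integral_profile_le
    rw [intervalIntegral.integral_of_le hrs.le]
    refine mul_le_mul_of_nonneg_left (setIntegral_mono_set hI ?_ hsub.eventuallyLE) (by positivity)
    filter_upwards [ae_restrict_mem measurableSet_Ioo] with t ht
    exact mul_nonneg ht.1.le (sq_nonneg _)
  set k := (profile u s - profile u r) / Real.log (s / r) with hk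
  have hquad : 0 ≤ ∫ t in r..s, (t * (U' t) ^ 2 - 2 * k * U' t + k ^ 2 * t⁻¹) := by
    refine intervalIntegral.integral_nonneg hrs.le fun t ht => ?_
    have ht0 : 0 < t := hr.trans_le ht.1
    have h1 : 0 ≤ t⁻¹ * (t * U' t - k) ^ 2 := by positivity
    have h2 : t⁻¹ * (t * U' t - k) ^ 2 = t * U' t ^ 2 - 2 * k * U' t + k ^ 2 * t⁻¹ := by
      field_simp; ring
    linarith
  rw [intervalIntegral.integral_add (hA.sub (hD.const_mul _)) (hinv.const_mul _),
    intervalIntegral.integral_sub hA (hD.const_mul _), intervalIntegral.integral_const_mul,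
    intervalIntegral.integral_const_mul, hftc, integral_inv_of_pos hr (hr.trans hrs)] at hquad
  have hkd : profile u s - profile u r = k * Real.log (s / r) := by rw [hk]; field_simp
  rw [hkd] at hquad ⊢
  have : k ^ 2 * Real.log (s / r) ≤ enormSq u / (2 * π) := by nlinarith
  calc (k * Real.log (s / r)) ^ 2 = (k ^ 2 * Real.log (s / r)) * Real.log (s / r) := by ring
    _ ≤ _ := by gcongr

lemma enormSq_nonneg (u : Pt → ℝ) : 0 ≤ enormSq u :=
  integral_nonneg fun _ => sq_nonneg _

lemma hInt_sq_nonneg (u : Pt → ℝ) : 0 ≤ hInt (fun x => u x ^ 2) :=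
  integral_nonneg fun _ => mul_nonneg (sq_nonneg _) (sq_nonneg _)

lemma not_integrableOn_annulus {r c : ℝ} (hr : 0 < r) (hr1 : r < 1) (hc : 0 < c) :
    ¬ IntegrableOn (fun t : ℝ => t * (c * (2 / (1 - t ^ 2)) ^ 2)) (Ioo r 1) := by
  intro hI
  have h1 : ¬ IntervalIntegrable (fun x : ℝ => (x - 1)⁻¹) volume r 1 := by
    rw [intervalIntegrable_sub_inv_iff]
    simp [hr1.ne]
  refine h1 ((intervalIntegrable_iff_integrableOn_Ioo_of_le hr1.le).2 ?_)
  refine Integrable.mono' (hI.const_mul ((r * c)⁻¹))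
    (by fun_prop : Measurable fun x : ℝ => (x - 1)⁻¹).aestronglyMeasurable ?_
  filter_upwards [ae_restrict_mem measurableSet_Ioo] with t ht
  have ht1 : 0 < 1 - t := sub_pos.2 ht.2
  have ht0 : 0 < t := hr.trans ht.1
  have h2 : 1 - t ^ 2 = (1 - t) * (1 + t) := by ring
  rw [norm_inv, Real.norm_eq_abs, abs_sub_comm, abs_of_pos ht1]
  have h3 : (1 : ℝ) ≤ t / r := by rw [le_div_iff₀ hr]; linarith [ht.1]
  have h4 : (1 - t)⁻¹ ≤ (2 / (1 - t ^ 2)) ^ 2 := by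
    have h5 : (1 - t)⁻¹ ≤ 2 / (1 - t ^ 2) := by
      rw [h2, inv_eq_one_div, div_le_div_iff₀ ht1 (by positivity)]
      nlinarith [ht.2]
    have h6 : 1 ≤ 2 / (1 - t ^ 2) := by
      rw [one_le_div (by rw [h2]; positivity)]; nlinarith
    nlinarith
  calc (1 - t)⁻¹ ≤ 1 * (2 / (1 - t ^ 2)) ^ 2 := by linarith
    _ ≤ t / r * (2 / (1 - t ^ 2)) ^ 2 := by gcongr
    _ = _ := by field_simp

/-- The radial pointwise estimate for `H¹_R(𝔹²)`-functions. -/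
lemma IsH1R.sq_profile_le {u : Pt → ℝ} (hu : IsH1R u) {r : ℝ} (hr : 0 < r) (hr1 : r < 1) :
    profile u r ^ 2 ≤ enormSq u / (2 * π) * (-Real.log r) := by
  by_contra! hcon
  have hA0 : 0 ≤ enormSq u / (2 * π) := div_nonneg (enormSq_nonneg u) (by positivity)
  set A := enormSq u / (2 * π)
  set d := |profile u r| - √(A * (-Real.log r)) with hd
  have hd0 : 0 < d := by
    rw [hd, sub_pos, Real.sqrt_lt' (abs_pos.2 ?_), sq_abs]
    · exact hcon
    · rintro h0
      have : 0 ≤ -Real.log r := by linarith [Real.log_nonpos hr.le hr1.le]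
      rw [h0] at hcon
      nlinarith [mul_nonneg hA0 this]
  have hlow : ∀ s ∈ Ioo r 1, d ^ 2 ≤ profile u s ^ 2 := by
    intro s hs
    have h1 := hu.sq_sub_le hr hs.1 hs.2
    have h2 : A * Real.log (s / r) ≤ A * (-Real.log r) := by
      gcongr
      rw [Real.log_div (hr.trans hs.1).ne' hr.ne']
      linarith [Real.log_nonpos (hr.trans hs.1).le hs.2.le]
    have h3 := Real.abs_le_sqrt (h1.trans h2)
    rw [← sq_abs (profile u s)]
    gcongr
    have := abs_sub_abs_le_abs_sub (profile u r) (profile u s)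
    rw [abs_sub_comm] at this
    linarith
  have hI : IntegrableOn (fun x : Pt => profile u ‖x‖ ^ 2 * (2 / (1 - ‖x‖ ^ 2)) ^ 2) B := by
    have := hu.1.2.2
    unfold HIntegrable dens at this
    simpa only [fun x => hu.eq_profile x] using this
  rw [integrable_radial_iff (fun t => profile u t ^ 2 * (2 / (1 - t ^ 2)) ^ 2)] at hI
  refine not_integrableOn_annulus hr hr1 (pow_pos hd0 2) ?_
  refine Integrable.mono' (hI.mono_set (Ioo_subset_Ioo_left hr.le))
    (by fun_prop : Measurable fun t : ℝ => t * (d ^ 2 * (2 / (1 - t ^ 2)) ^ 2)).aestronglyMeasurable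
    ?_
  filter_upwards [ae_restrict_mem measurableSet_Ioo] with t ht
  have ht0 : 0 < t := hr.trans ht.1
  rw [Real.norm_of_nonneg (by positivity)]
  exact mul_le_mul_of_nonneg_left (mul_le_mul_of_nonneg_right (hlow t ht) (sq_nonneg _)) ht0.le

/-- A majorant of the weights arising near the centre and near the boundary of the disc. -/
lemma exists_radial_majorant {p q : ℝ} (hp : 3 / 2 ≤ p) (hq0 : 0 ≤ q) (hq : q < 2) :
    ∃ D : ℝ → ℝ, IntegrableOn (fun x : Pt => D ‖x‖) B ∧ ∀ r ∈ Ioo (0 : ℝ) 1,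
      (-Real.log r) ^ p * r ^ (-q) * (2 / (1 - r ^ 2)) ^ 2 ≤ D r := by
  have hp0 : 0 < p := by linarith
  set δ := (2 - q) / (2 * p) with hδ
  have hδ0 : 0 < δ := div_pos (by linarith) (by linarith)
  have hδp : δ * p = (2 - q) / 2 := by rw [hδ]; field_simp
  refine ⟨fun r => 8 * (1 / δ) ^ p * r ^ (-((2 + q) / 2)) + 2 ^ p * 2 ^ q * 4 * (1 - r) ^ (-(1 / 2) : ℝ),
    ?_, ?_⟩
  · rw [integrable_radial_iff (fun r => 8 * (1 / δ) ^ p * r ^ (-((2 + q) / 2)) +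
      2 ^ p * 2 ^ q * 4 * (1 - r) ^ (-(1 / 2) : ℝ))]
    have h1 : IntegrableOn (fun t : ℝ => t ^ (1 - (2 + q) / 2)) (Ioo 0 1) :=
      (intervalIntegrable_iff_integrableOn_Ioo_of_le zero_le_one).1
        (intervalIntegral.intervalIntegrable_rpow' (by linarith))
    have h2 : IntegrableOn (fun t : ℝ => (1 - t) ^ (-(1 / 2) : ℝ)) (Ioo 0 1) := by
      have h3 : IntervalIntegrable (fun t : ℝ => t ^ (-(1 / 2) : ℝ)) volume 0 1 :=
        intervalIntegral.intervalIntegrable_rpow' (by norm_num)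
      have h4 := (h3.comp_sub_left 1).symm
      simp only [sub_self, sub_zero] at h4
      exact (intervalIntegrable_iff_integrableOn_Ioo_of_le zero_le_one).1 h4
    refine Integrable.mono' ((h1.const_mul (8 * (1 / δ) ^ p)).add
      (h2.const_mul (2 ^ p * 2 ^ q * 4))) (Measurable.aestronglyMeasurable (by fun_prop)) ?_
    filter_upwards [ae_restrict_mem measurableSet_Ioo] with t ht
    have ht1 : 0 < 1 - t := sub_pos.2 ht.2
    have ht0 : 0 < t := ht.1
    rw [Real.norm_of_nonneg (by positivity), mul_add, Pi.add_apply]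
    refine add_le_add (le_of_eq ?_) (mul_le_of_le_one_left (by positivity) ht.2.le)
    rw [sub_eq_add_neg 1 ((2 + q) / 2), Real.rpow_add ht0, Real.rpow_one]
    ring
  · rintro r ⟨hr0, hr1⟩
    have hr1' : 0 < 1 - r := sub_pos.2 hr1
    have hL : 0 ≤ -Real.log r := by linarith [Real.log_nonpos hr0.le hr1.le]
    have hsq : 0 < 1 - r ^ 2 := by nlinarith
    rcases le_total r (1 / 2) with hr | hr
    · have h1 : (-Real.log r) ^ p ≤ (1 / δ) ^ p * r ^ (-(δ * p)) := by
        have h2 : -Real.log r ≤ 1 / δ * r ^ (-δ) := by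
          have := Real.log_le_rpow_div (x := r⁻¹) (by positivity) hδ0
          rw [Real.log_inv, Real.inv_rpow hr0.le, ← Real.rpow_neg hr0.le] at this
          rwa [one_div_mul_eq_div]
        calc _ ≤ (1 / δ * r ^ (-δ)) ^ p := Real.rpow_le_rpow hL h2 hp0.le
          _ = _ := by rw [Real.mul_rpow (by positivity) (by positivity), ← Real.rpow_mul hr0.le,
                neg_mul]
      have h2 : (2 / (1 - r ^ 2)) ^ 2 ≤ 8 := by
        have : 2 / (1 - r ^ 2) ≤ 8 / 3 := by
          rw [div_le_div_iff₀ hsq (by norm_num)]; nlinarith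
        have h0 : 0 ≤ 2 / (1 - r ^ 2) := by positivity
        nlinarith
      have h3 : r ^ (-((2 + q) / 2)) = r ^ (-(δ * p)) * r ^ (-q) := by
        rw [← Real.rpow_add hr0, hδp]; congr 1; ring
      calc _ ≤ (1 / δ) ^ p * r ^ (-(δ * p)) * r ^ (-q) * 8 := by gcongr
        _ = 8 * (1 / δ) ^ p * r ^ (-((2 + q) / 2)) := by rw [h3]; ring
        _ ≤ _ := le_add_of_nonneg_right (by positivity)
    · have h1 : (-Real.log r) ^ p ≤ 2 ^ p * (1 - r) ^ (3 / 2 : ℝ) := by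
        have h2 : -Real.log r ≤ 2 * (1 - r) := by
          have h3 := Real.one_sub_inv_le_log_of_pos hr0
          have h4 : r⁻¹ - 1 ≤ 2 * (1 - r) := by
            rw [inv_eq_one_div, div_sub_one hr0.ne', div_le_iff₀ hr0]; nlinarith
          linarith
        calc _ ≤ (2 * (1 - r)) ^ p := Real.rpow_le_rpow hL h2 hp0.le
          _ = 2 ^ p * (1 - r) ^ p := Real.mul_rpow (by norm_num) hr1'.le
          _ ≤ _ := by
            gcongr ?_ * ?_
            exact Real.rpow_le_rpow_of_exponent_ge hr1' (by linarith) hp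
      have h2 : r ^ (-q) ≤ 2 ^ q := by
        rw [Real.rpow_neg hr0.le, ← Real.inv_rpow hr0.le]
        refine Real.rpow_le_rpow (by positivity) ?_ hq0
        rw [inv_le_comm₀ hr0 (by norm_num)]; linarith
      have h3 : (2 / (1 - r ^ 2)) ^ 2 ≤ 4 * (1 - r) ^ (-2 : ℝ) := by
        rw [Real.rpow_neg hr1'.le, Real.rpow_two, div_pow, div_eq_mul_inv]
        have : 1 - r ≤ 1 - r ^ 2 := by nlinarith
        norm_num only
        gcongr
      have h4 : (1 - r) ^ (-(1 / 2) : ℝ) = (1 - r) ^ (3 / 2 : ℝ) * (1 - r) ^ (-2 : ℝ) := by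
        rw [← Real.rpow_add hr1']; norm_num
      calc _ ≤ 2 ^ p * (1 - r) ^ (3 / 2 : ℝ) * 2 ^ q * (4 * (1 - r) ^ (-2 : ℝ)) := by gcongr
        _ = 2 ^ p * 2 ^ q * 4 * (1 - r) ^ (-(1 / 2) : ℝ) := by rw [h4]; ring
        _ ≤ _ := le_add_of_nonneg_left (by positivity)

lemma fq_eq_div (lam : ℝ) (h : Pt → ℝ → ℝ) (x : Pt) (t : ℝ) :
    fq lam h x t = fn lam h x t / t := by
  unfold fq
  split_ifs with ht <;> simp [ht]

lemma exp_sub_one_le {s : ℝ} : Real.exp s - 1 ≤ s * Real.exp s := by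
  have h1 := Real.add_one_le_exp (-s)
  have h2 : Real.exp (-s) * Real.exp s = 1 := by rw [← Real.exp_add]; simp
  nlinarith [Real.exp_pos s]

lemma CriticalGrowth.exists_abs_h_le {lam : ℝ} {h : Pt → ℝ → ℝ} (hf : CriticalGrowth lam h)
    {ε : ℝ} (hε : 0 < ε) :
    ∃ C : ℝ, 0 ≤ C ∧ ∀ x ∈ B, ∀ t : ℝ, 0 < t → |h x t| ≤ C * Real.exp (ε * t ^ 2) := by
  obtain ⟨T, hT⟩ := hf.h_sup ε hε 1 one_pos
  obtain ⟨C, hC⟩ := hf.h_bdd (max T 1) (by positivity)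
  refine ⟨max C 1, by positivity, fun x hx t ht => ?_⟩
  rcases le_total t (max T 1) with h1 | h1
  · have h2 := (hC x hx t (by rwa [abs_of_pos ht])).trans (le_max_left C 1)
    exact h2.trans (le_mul_of_one_le_right (by positivity) (Real.one_le_exp (by positivity)))
  · have hh : 0 < h x t :=
      pos_of_mul_pos_left (hf.f_pos x hx t ht) (sub_nonneg.2 (Real.one_le_exp
        (mul_nonneg hf.lam_pos.le (sq_nonneg t))))
    have h2 := hT t ((le_max_left _ _).trans h1) x hx
    rw [neg_mul, Real.exp_neg, ← div_eq_mul_inv, div_lt_one (Real.exp_pos _)] at h2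
    rw [abs_of_pos hh]
    exact h2.le.trans (le_mul_of_one_le_left (Real.exp_pos _).le (le_max_right _ _))

lemma CriticalGrowth.exists_abs_fq_le {lam : ℝ} {h : Pt → ℝ → ℝ} (hf : CriticalGrowth lam h)
    {ε : ℝ} (hε : 0 < ε) :
    ∃ C : ℝ, 0 ≤ C ∧ ∀ x ∈ B, ∀ t : ℝ,
      |fq lam h x t| ≤ C * |t| * Real.exp ((lam + ε) * t ^ 2) := by
  obtain ⟨C, hC0, hC⟩ := hf.exists_abs_h_le hε
  have hl := hf.lam_pos
  have key : ∀ x ∈ B, ∀ t : ℝ, 0 < t →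
      |fq lam h x t| ≤ C * lam * |t| * Real.exp ((lam + ε) * t ^ 2) := by
    intro x hx t ht
    have h1 : 0 ≤ Real.exp (lam * t ^ 2) - 1 := sub_nonneg.2 (Real.one_le_exp (by positivity))
    rw [fq_eq_div, fn, abs_div, abs_mul, abs_of_nonneg h1, abs_of_pos ht, div_le_iff₀ ht]
    calc _ ≤ C * Real.exp (ε * t ^ 2) * (lam * t ^ 2 * Real.exp (lam * t ^ 2)) :=
          mul_le_mul (hC x hx t ht) exp_sub_one_le h1 (by positivity)
      _ = _ := by rw [add_mul, Real.exp_add]; ring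
  refine ⟨C * lam, by positivity, fun x hx t => ?_⟩
  rcases lt_trichotomy t 0 with ht | rfl | ht
  · have h1 : fq lam h x t = fq lam h x (-t) := by
      rw [fq_eq_div, fq_eq_div, hf.f_odd x hx, neg_div_neg_eq]
    simpa [h1] using key x hx (-t) (by linarith)
  · simp [fq]
  · exact key x hx t ht

lemma CriticalGrowth.continuous_fn {lam : ℝ} {h : Pt → ℝ → ℝ} (hf : CriticalGrowth lam h) :
    Continuous (fun z : Pt × ℝ => fn lam h z.1 z.2) := by
  have h1 : Continuous (fun z : Pt × ℝ => h z.1 z.2) := hf.h_C1.continuous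
  unfold fn
  fun_prop

lemma CriticalGrowth.continuous_fq {lam : ℝ} {h : Pt → ℝ → ℝ} (hf : CriticalGrowth lam h)
    {x : Pt} (hx : x ∈ B) : Continuous (fq lam h x) := by
  rw [continuous_iff_continuousAt]
  intro t
  rcases eq_or_ne t 0 with rfl | ht
  · obtain ⟨C, -, hC⟩ := hf.exists_abs_fq_le one_pos
    have h0 : Tendsto (fun t : ℝ => C * |t| * Real.exp ((lam + 1) * t ^ 2)) (nhds 0) (nhds 0) := by
      have : Continuous (fun t : ℝ => C * |t| * Real.exp ((lam + 1) * t ^ 2)) := by fun_prop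
      simpa using this.tendsto 0
    have h2 : fq lam h x 0 = 0 := by simp [fq]
    rw [ContinuousAt, h2]
    exact squeeze_zero_norm (fun t => hC x hx t) h0
  · have h1 : fq lam h x = fun t => fn lam h x t / t := funext (fq_eq_div lam h x)
    rw [h1]
    have h2 : Continuous (fun t : ℝ => fn lam h x t) :=
      hf.continuous_fn.comp (Continuous.prodMk_right x)
    exact h2.continuousAt.div continuousAt_id ht

lemma CriticalGrowth.aestronglyMeasurable_integrand {lam : ℝ} {h : Pt → ℝ → ℝ}
    (hf : CriticalGrowth lam h) {u v : Pt → ℝ} (hu : IsH1R u) (hv : IsH1R v) (l : ℕ) :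
    AEStronglyMeasurable (fun x => fq lam h x (u x) * v x ^ l * dens x) (volume.restrict B) := by
  have hum := (hu.1.1.continuousOn.aestronglyMeasurable measurableSet_B (μ := volume)).aemeasurable
  have hvm := (hv.1.1.continuousOn.aestronglyMeasurable measurableSet_B (μ := volume)).aemeasurable
  have hfm : AEMeasurable (fun x => fn lam h x (u x)) (volume.restrict B) :=
    hf.continuous_fn.measurable.comp_aemeasurable (aemeasurable_id.prodMk hum)
  have hdm : Measurable dens := by unfold dens; fun_prop
  simp only [fq_eq_div]
  exact (((hfm.div hum).mul (hvm.pow_const l)).mul hdm.aemeasurable).aestronglyMeasurable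

lemma norm_integrand_le {lam : ℝ} {h : Pt → ℝ → ℝ} {x : Pt} {s t a b c C : ℝ}
    {l : ℕ} (hC0 : 0 ≤ C) (hc : 0 ≤ c) (ha : 0 ≤ a) (hb : 0 ≤ b)
    (hx0 : 0 < ‖x‖) (hx1 : ‖x‖ < 1)
    (hC : |fq lam h x s| ≤ C * |s| * Real.exp (c * s ^ 2))
    (hs : s ^ 2 ≤ a * (-Real.log ‖x‖)) (ht : t ^ 2 ≤ b * (-Real.log ‖x‖)) :
    ‖fq lam h x s * t ^ l * dens x‖ ≤ C * √a * √b ^ l *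
      ((-Real.log ‖x‖) ^ ((l + 1 : ℝ) / 2) * ‖x‖ ^ (-(c * a)) * (2 / (1 - ‖x‖ ^ 2)) ^ 2) := by
  have hL : 0 ≤ -Real.log ‖x‖ := by linarith [Real.log_nonpos hx0.le hx1.le]
  have hs' : |s| ≤ √a * √(-Real.log ‖x‖) := by
    rw [← Real.sqrt_mul ha]; exact Real.abs_le_sqrt hs
  have ht' : |t| ≤ √b * √(-Real.log ‖x‖) := by
    rw [← Real.sqrt_mul hb]; exact Real.abs_le_sqrt ht
  have hexp : Real.exp (c * s ^ 2) ≤ ‖x‖ ^ (-(c * a)) := by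
    rw [Real.rpow_def_of_pos hx0, Real.exp_le_exp]
    nlinarith [mul_le_mul_of_nonneg_left hs hc]
  have hpow : (-Real.log ‖x‖) ^ ((l + 1 : ℝ) / 2) = √(-Real.log ‖x‖) ^ (l + 1) := by
    rw [Real.sqrt_eq_rpow, ← Real.rpow_natCast, ← Real.rpow_mul hL]
    push_cast
    congr 1
    ring
  have hd : 0 ≤ dens x := sq_nonneg _
  rw [norm_mul, norm_mul, Real.norm_eq_abs, norm_pow, Real.norm_eq_abs, Real.norm_of_nonneg hd, hpow]
  calc _ ≤ (C * (√a * √(-Real.log ‖x‖)) * ‖x‖ ^ (-(c * a))) * (√b * √(-Real.log ‖x‖)) ^ l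
        * dens x := by
        gcongr
        exact hC.trans (by gcongr)
    _ = _ := by unfold dens; ring

/-- If `{u_k}`, `{v_k}` are bounded sequences in `H¹_R(𝔹²)` converging a.e. to
`u`, `v` respectively, and `sup_k ‖u_k‖² < 4π/λ`, then for every `l ≥ 2`,
`∫_B (f(x,u_k)/u_k) v_kˡ dv_g → ∫_B (f(x,u)/u) vˡ dv_g`. -/
theorem stmt15 (lam : ℝ) (h : Pt → ℝ → ℝ) (hf : CriticalGrowth lam h)
    (u v : ℕ → Pt → ℝ) (u₀ v₀ : Pt → ℝ)
    (huk : ∀ k, IsH1R (u k)) (hvk : ∀ k, IsH1R (v k))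
    (hu₀ : IsH1R u₀) (hv₀ : IsH1R v₀)
    (hubdd : ∃ M : ℝ, ∀ k, enormSq (u k) + hInt (fun x => (u k x) ^ 2) ≤ M)
    (hvbdd : ∃ M : ℝ, ∀ k, enormSq (v k) + hInt (fun x => (v k x) ^ 2) ≤ M)
    (huae : ∀ᵐ x ∂(volume.restrict B), Tendsto (fun k => u k x) atTop (nhds (u₀ x)))
    (hvae : ∀ᵐ x ∂(volume.restrict B), Tendsto (fun k => v k x) atTop (nhds (v₀ x)))
    (hsub : ∃ M : ℝ, M < 4 * π / lam ∧ ∀ k, enormSq (u k) ≤ M) :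
    ∀ l : ℕ, 2 ≤ l →
      Tendsto (fun k => hInt (fun x => fq lam h x (u k x) * (v k x) ^ l)) atTop
        (nhds (hInt (fun x => fq lam h x (u₀ x) * (v₀ x) ^ l))) := by
  intro l hl
  obtain ⟨M, hM, huM⟩ := hsub
  obtain ⟨N, hN⟩ := hvbdd
  have hvN : ∀ k, enormSq (v k) ≤ N := fun k => by linarith [hN k, hInt_sq_nonneg (v k)]
  have hM0 : 0 ≤ M := (enormSq_nonneg _).trans (huM 0)
  have hN0 : 0 ≤ N := (enormSq_nonneg _).trans (hvN 0)
  have hlam := hf.lam_pos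
  obtain ⟨ε, hε, hεM⟩ : ∃ ε : ℝ, 0 < ε ∧ (lam + ε) * M < 4 * π := by
    have h1 : 0 < 4 * π - lam * M := by rw [lt_div_iff₀ hlam] at hM; linarith
    refine ⟨(4 * π - lam * M) / (M + 1), by positivity, ?_⟩
    have h2 : (4 * π - lam * M) / (M + 1) * M < 4 * π - lam * M := by
      rw [div_mul_eq_mul_div, div_lt_iff₀ (by positivity)]
      nlinarith
    linarith
  obtain ⟨C, hC0, hC⟩ := hf.exists_abs_fq_le hε
  have hq : (lam + ε) * (M / (2 * π)) < 2 := by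
    rw [← mul_div_assoc, div_lt_iff₀ (by positivity)]; linarith
  have hl' : (2 : ℝ) ≤ l := by exact_mod_cast hl
  obtain ⟨D, hD, hDle⟩ := exists_radial_majorant (p := (l + 1 : ℝ) / 2) (by linarith)
    (by positivity) hq
  refine tendsto_integral_of_dominated_convergence
    (fun x => C * √(M / (2 * π)) * √(N / (2 * π)) ^ l * D ‖x‖)
    (fun k => hf.aestronglyMeasurable_integrand (huk k) (hvk k) l) (hD.const_mul _)
    (fun k => ?_) ?_
  · filter_upwards [ae_restrict_B_ne_zero] with x hx
    have hx0 : 0 < ‖x‖ := norm_pos_iff.2 hx.2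
    have hx1 : ‖x‖ < 1 := mem_ball_zero_iff.1 hx.1
    have hL : 0 ≤ -Real.log ‖x‖ := by linarith [Real.log_nonpos hx0.le hx1.le]
    have hbound : ∀ {w : Pt → ℝ} {A : ℝ}, IsH1R w → enormSq w ≤ A →
        w x ^ 2 ≤ A / (2 * π) * (-Real.log ‖x‖) := fun {w A} hw hA => by
      rw [hw.eq_profile x]
      exact (hw.sq_profile_le hx0 hx1).trans (by gcongr)
    refine (norm_integrand_le hC0 (by positivity) (by positivity) (by positivity)
      hx0 hx1 (hC x hx.1 _) (hbound (huk k) (huM k)) (hbound (hvk k) (hvN k))).trans ?_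
    gcongr
    exact hDle _ ⟨hx0, hx1⟩
  · filter_upwards [ae_restrict_B_ne_zero, huae, hvae] with x hx hxu hxv
    exact ((((hf.continuous_fq hx.1).tendsto _).comp hxu).mul (hxv.pow l)).mul_const _
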